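/- Let n ≥ 1, 1 < p < ∞, 0 < α < n/p, and define 1/r = 1/p − α/n. If f ∈ L^{n/(n−α),∞}(ℝⁿ) and φ ∈ L^p(ℝⁿ), then f∗φ ∈ L^r(ℝⁿ) and ‖f∗φ‖_r ≤ 3 r (p/(p−1)) (p/r)^{1/p − 1/r} ‖f‖_{n/(n−α),∞} ‖φ‖_p. -/

import Mathlib

open MeasureTheory Set
open scoped ENNReal

/-- Distribution function: `μ {x : |f x| > s}`. -/
noncomputable def distrib {X : Type*} [MeasurableSpace X] (μ : Measure X)
    (f : X → ℝ) (s : ℝ) : ℝ≥0∞ :=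
  μ {x | s < |f x|}

/-- Decreasing rearrangement: `f*(t) = inf {s > 0 : λ_f(s) ≤ t}`. -/
noncomputable def rearr {X : Type*} [MeasurableSpace X] (μ : Measure X)
    (f : X → ℝ) (t : ℝ) : ℝ≥0∞ :=
  ⨅ (s : ℝ) (_ : 0 < s ∧ distrib μ f s ≤ ENNReal.ofReal t), ENNReal.ofReal s

/-- Maximal function `f**(t) = (1/t) ∫₀ᵗ f*(u) du`. -/
noncomputable def maxFn {X : Type*} [MeasurableSpace X] (μ : Measure X)
    (f : X → ℝ) (t : ℝ) : ℝ≥0∞ :=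
  (ENNReal.ofReal t)⁻¹ * ∫⁻ u in Set.Ioc (0:ℝ) t, rearr μ f u

/-- Lorentz norm `‖f‖_{p,q}`; for `q = ∞` it is `sup_{t>0} t^{1/p} f**(t)`. -/
noncomputable def lorentzNorm {X : Type*} [MeasurableSpace X] (μ : Measure X)
    (f : X → ℝ) (p : ℝ) (q : ℝ≥0∞) : ℝ≥0∞ :=
  if q = ⊤ then ⨆ (t : ℝ) (_ : 0 < t), ENNReal.ofReal t ^ (1/p) * maxFn μ f t
  else (∫⁻ t in Set.Ioi (0:ℝ),
      (ENNReal.ofReal t ^ (1/p) * maxFn μ f t) ^ q.toReal * (ENNReal.ofReal t)⁻¹) ^ (1 / q.toReal)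

/-- Convolution on ℝⁿ: `(f ∗ g)(x) = ∫ f(x-y) g(y) dy`. -/
noncomputable def conv {n : ℕ} (f g : EuclideanSpace ℝ (Fin n) → ℝ)
    (x : EuclideanSpace ℝ (Fin n)) : ℝ :=
  ∫ y, f (x - y) * g y

/-- `‖f‖_p = (∫ |f|^p dμ)^{1/p}`. -/
noncomputable def lpNorm {X : Type*} [MeasurableSpace X] (μ : Measure X)
    (f : X → ℝ) (p : ℝ) : ℝ≥0∞ :=
  (∫⁻ x, ENNReal.ofReal |f x| ^ p ∂μ) ^ (1/p)

/-- Riesz potential `I_α f(x) = ∫ |x-y|^{α-n} f(y) dy` on ℝⁿ. -/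
noncomputable def riesz (n : ℕ) (α : ℝ) (f : EuclideanSpace ℝ (Fin n) → ℝ)
    (x : EuclideanSpace ℝ (Fin n)) : ℝ :=
  ∫ y, ‖x - y‖ ^ (α - (n:ℝ)) * f y

/-- `∫₀ᵛ t^(a-1) dt = v^a / a`. -/
lemma lintegral_Ioc_rpow_sub_one {a v : ℝ} (ha : 0 < a) (hv : 0 ≤ v) :
    ∫⁻ t in Ioc (0:ℝ) v, ENNReal.ofReal (t ^ (a - 1)) = ENNReal.ofReal (v ^ a / a) := by
  have hint : IntervalIntegrable (fun t : ℝ => t ^ (a - 1)) volume 0 v :=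
    intervalIntegral.intervalIntegrable_rpow' (by linarith)
  rw [← ofReal_integral_eq_lintegral_ofReal, ← intervalIntegral.integral_of_le hv,
    integral_rpow (Or.inl (by linarith))]
  · simp [Real.zero_rpow ha.ne']
  · exact (intervalIntegrable_iff_integrableOn_Ioc_of_le hv).1 hint
  · filter_upwards [ae_restrict_mem measurableSet_Ioc] with t ht
    exact Real.rpow_nonneg ht.1.le _

/-- `∫ᵥ^∞ t^(-b-1) dt = v^(-b) / b`. -/
lemma lintegral_Ioi_rpow_neg_sub_one {b v : ℝ} (hb : 0 < b) (hv : 0 < v) :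
    ∫⁻ t in Ioi v, ENNReal.ofReal (t ^ (-b - 1)) = ENNReal.ofReal (v ^ (-b) / b) := by
  rw [← ofReal_integral_eq_lintegral_ofReal, integral_Ioi_rpow_of_lt (by linarith) hv]
  · congr 1
    rw [sub_add_cancel, neg_div_neg_eq]
  · exact integrableOn_Ioi_rpow_of_lt (by linarith) hv
  · filter_upwards [ae_restrict_mem measurableSet_Ioi] with t ht
    exact Real.rpow_nonneg (hv.trans ht).le _

lemma setOf_ofReal_lt_inter_Ioi (x : ℝ) :
    {s : ℝ | ENNReal.ofReal s < ENNReal.ofReal x} ∩ Ioi 0 = Ioo 0 x := by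
  ext s
  simp only [mem_inter_iff, mem_ofPred_eq, mem_Ioi, mem_Ioo]
  constructor
  · rintro ⟨h1, h2⟩
    exact ⟨h2, (ENNReal.ofReal_lt_ofReal_iff_of_nonneg h2.le).1 h1⟩
  · rintro ⟨h1, h2⟩
    exact ⟨(ENNReal.ofReal_lt_ofReal_iff_of_nonneg h1.le).2 h2, h1⟩

lemma lintegral_Ioi_indicator_ofReal_lt (X : ℝ≥0∞) {p : ℝ} (hp : 0 < p) :
    ∫⁻ s in Ioi (0:ℝ), {s : ℝ | ENNReal.ofReal s < X}.indicator
      (fun s => ENNReal.ofReal (p * s ^ (p - 1))) s = X ^ p := by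
  have hmeas (Y : ℝ≥0∞) : MeasurableSet {s : ℝ | ENNReal.ofReal s < Y} :=
    measurableSet_lt ENNReal.measurable_ofReal measurable_const
  have key (x : ℝ) (hx : 0 ≤ x) : ∫⁻ s in Ioi (0:ℝ),
      {s : ℝ | ENNReal.ofReal s < ENNReal.ofReal x}.indicator
        (fun s => ENNReal.ofReal (p * s ^ (p - 1))) s = ENNReal.ofReal x ^ p := by
    rw [lintegral_indicator (hmeas _), Measure.restrict_restrict (hmeas _),
      setOf_ofReal_lt_inter_Ioi, restrict_Ioo_eq_restrict_Ioc]
    simp_rw [ENNReal.ofReal_mul hp.le]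
    rw [lintegral_const_mul _ (by fun_prop), lintegral_Ioc_rpow_sub_one hp hx,
      ← ENNReal.ofReal_mul hp.le, mul_div_cancel₀ _ hp.ne',
      ENNReal.ofReal_rpow_of_nonneg hx hp.le]
  rcases eq_or_ne X ⊤ with rfl | hX
  · rw [ENNReal.top_rpow_of_pos hp, ← top_le_iff]
    refine ENNReal.le_of_forall_nnreal_lt fun r _ => ?_
    have h1 := key ((r : ℝ) ^ (1 / p)) (by positivity)
    rw [ENNReal.ofReal_rpow_of_nonneg (by positivity) hp.le, ← Real.rpow_mul (by positivity),
      one_div_mul_cancel hp.ne', Real.rpow_one, ENNReal.ofReal_coe_nnreal] at h1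
    rw [← h1]
    refine lintegral_mono fun s => ?_
    exact indicator_le_indicator_of_subset (fun s _ => ENNReal.ofReal_lt_top)
      (fun _ => zero_le) s
  · have := key X.toReal ENNReal.toReal_nonneg
    rwa [ENNReal.ofReal_toReal hX] at this

/-- Layer cake formula for `ℝ≥0∞`-valued functions. -/
lemma lintegral_rpow_eq_lintegral_measure_ofReal_lt {X : Type*} [MeasurableSpace X]
    (μ : Measure X) [SFinite μ] {g : X → ℝ≥0∞} (hg : Measurable g) {p : ℝ} (hp : 0 < p) :
    ∫⁻ x, g x ^ p ∂μ =
      ∫⁻ s in Ioi (0:ℝ), ENNReal.ofReal (p * s ^ (p - 1)) * μ {x | ENNReal.ofReal s < g x} := by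
  simp_rw [← lintegral_Ioi_indicator_ofReal_lt _ hp]
  rw [lintegral_lintegral_swap]
  · refine lintegral_congr fun s => ?_
    have hms : MeasurableSet {x | ENNReal.ofReal s < g x} := measurableSet_lt measurable_const hg
    rw [← lintegral_indicator_const hms]
    exact lintegral_congr fun x => rfl
  · have hms : MeasurableSet {z : X × ℝ | ENNReal.ofReal z.2 < g z.1} :=
      measurableSet_lt (by fun_prop) (by fun_prop)
    exact (Measurable.indicator (f := fun z : X × ℝ => ENNReal.ofReal (p * z.2 ^ (p - 1)))
      (by fun_prop) hms).aemeasurable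

lemma lintegral_eq_lintegral_measure_ofReal_lt {X : Type*} [MeasurableSpace X]
    (μ : Measure X) [SFinite μ] {g : X → ℝ≥0∞} (hg : Measurable g) :
    ∫⁻ x, g x ∂μ = ∫⁻ s in Ioi (0:ℝ), μ {x | ENNReal.ofReal s < g x} := by
  simpa using lintegral_rpow_eq_lintegral_measure_ofReal_lt μ hg one_pos

/-- Integrals of powers are monotone in the distribution function. -/
lemma lintegral_rpow_le_of_measure_le {X Y : Type*} [MeasurableSpace X] [MeasurableSpace Y]
    {μ : Measure X} {ν : Measure Y} [SFinite μ] [SFinite ν] {g : X → ℝ≥0∞} {h : Y → ℝ≥0∞}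
    (hg : Measurable g) (hh : Measurable h) {p : ℝ} (hp : 0 < p)
    (H : ∀ s : ℝ, 0 < s → μ {x | ENNReal.ofReal s < g x} ≤ ν {y | ENNReal.ofReal s < h y}) :
    ∫⁻ x, g x ^ p ∂μ ≤ ∫⁻ y, h y ^ p ∂ν := by
  rw [lintegral_rpow_eq_lintegral_measure_ofReal_lt μ hg hp,
    lintegral_rpow_eq_lintegral_measure_ofReal_lt ν hh hp]
  refine setLIntegral_mono' measurableSet_Ioi fun s hs => ?_
  gcongr
  exact H s hs

lemma distrib_antitone {X : Type*} [MeasurableSpace X] (μ : Measure X) (f : X → ℝ) :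
    Antitone (distrib μ f) :=
  fun _ _ h => measure_mono fun _ hx => lt_of_le_of_lt h hx

lemma measure_ofReal_lt_eq_distrib {X : Type*} [MeasurableSpace X] (μ : Measure X) (f : X → ℝ)
    {s : ℝ} (hs : 0 ≤ s) : μ {x | ENNReal.ofReal s < ENNReal.ofReal |f x|} = distrib μ f s := by
  simp only [distrib, ENNReal.ofReal_lt_ofReal_iff_of_nonneg hs]

/-- `|{s > 0 : λ_f(s) > t}|`, which is the decreasing rearrangement of `f` at `t`. -/
noncomputable def distribInv {X : Type*} [MeasurableSpace X] (μ : Measure X)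
    (f : X → ℝ) (t : ℝ) : ℝ≥0∞ :=
  volume.restrict (Ioi (0:ℝ)) {s | ENNReal.ofReal t < distrib μ f s}

lemma distribInv_antitone {X : Type*} [MeasurableSpace X] (μ : Measure X) (f : X → ℝ) :
    Antitone (distribInv μ f) :=
  fun _ _ h => measure_mono fun _ hx => lt_of_le_of_lt (ENNReal.ofReal_le_ofReal h) hx

lemma distribInv_le {X : Type*} [MeasurableSpace X] (μ : Measure X) (f : X → ℝ) {s t : ℝ}
    (h : distrib μ f s ≤ ENNReal.ofReal t) : distribInv μ f t ≤ ENNReal.ofReal s := by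
  have hms : MeasurableSet {s | ENNReal.ofReal t < distrib μ f s} :=
    measurableSet_lt measurable_const (distrib_antitone μ f).measurable
  rw [distribInv, Measure.restrict_apply hms]
  calc _ ≤ volume (Ioc 0 s) := by
        refine measure_mono fun s' hs' => ⟨hs'.2, ?_⟩
        by_contra! hlt
        exact absurd hs'.1 (not_lt.2 ((distrib_antitone μ f hlt.le).trans h))
    _ = ENNReal.ofReal s := by simp

lemma distribInv_le_rearr {X : Type*} [MeasurableSpace X] (μ : Measure X) (f : X → ℝ) (t : ℝ) :
    distribInv μ f t ≤ rearr μ f t :=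
  le_iInf₂ fun _ hs => distribInv_le μ f hs.2

lemma lintegral_distribInv_rpow_le {X : Type*} [MeasurableSpace X] (μ : Measure X) [SFinite μ]
    {f : X → ℝ} (hf : Measurable f) {p : ℝ} (hp : 0 < p) :
    ∫⁻ t in Ioi (0:ℝ), distribInv μ f t ^ p ≤ ∫⁻ x, ENNReal.ofReal |f x| ^ p ∂μ := by
  refine lintegral_rpow_le_of_measure_le (distribInv_antitone μ f).measurable
    (by fun_prop) hp fun s hs => ?_
  have hms : MeasurableSet {t | ENNReal.ofReal s < distribInv μ f t} :=
    measurableSet_lt measurable_const (distribInv_antitone μ f).measurable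
  rw [measure_ofReal_lt_eq_distrib μ f hs.le, Measure.restrict_apply hms]
  rcases eq_or_ne (distrib μ f s) ⊤ with h | h
  · simp [h]
  calc _ ≤ volume (Ioc 0 (distrib μ f s).toReal) := by
        refine measure_mono fun t ht => ⟨ht.2, ?_⟩
        by_contra! hlt
        refine absurd ht.1 (not_lt.2 (distribInv_le μ f ?_))
        exact (ENNReal.le_ofReal_iff_toReal_le h (le_of_lt ht.2)).2 hlt.le
    _ = distrib μ f s := by simp [h]

/-- Hardy–Littlewood inequality for the integral over a set. -/
lemma setLIntegral_le_lintegral_rearr {X : Type*} [MeasurableSpace X] (μ : Measure X) [SFinite μ]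
    {f : X → ℝ} (hf : Measurable f) {E : Set X} {t : ℝ} (hE : μ E = ENNReal.ofReal t) :
    ∫⁻ x in E, ENNReal.ofReal |f x| ∂μ ≤ ∫⁻ u in Ioc (0:ℝ) t, rearr μ f u := by
  have hms : MeasurableSet {z : ℝ × ℝ | ENNReal.ofReal z.2 < distrib μ f z.1} :=
    measurableSet_lt (by fun_prop) ((distrib_antitone μ f).measurable.comp measurable_fst)
  calc ∫⁻ x in E, ENNReal.ofReal |f x| ∂μ
      = ∫⁻ s in Ioi (0:ℝ), μ.restrict E {x | ENNReal.ofReal s < ENNReal.ofReal |f x|} :=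
        lintegral_eq_lintegral_measure_ofReal_lt _ (by fun_prop)
    _ ≤ ∫⁻ s in Ioi (0:ℝ), ∫⁻ u in Ioc (0:ℝ) t,
          {u : ℝ | ENNReal.ofReal u < distrib μ f s}.indicator 1 u := by
        refine setLIntegral_mono' measurableSet_Ioi fun s hs => ?_
        have hms' : MeasurableSet {u : ℝ | ENNReal.ofReal u < distrib μ f s} :=
          measurableSet_lt (by fun_prop) measurable_const
        rw [lintegral_indicator_one hms', Measure.restrict_apply hms']
        have h1 : μ.restrict E {x | ENNReal.ofReal s < ENNReal.ofReal |f x|} ≤ distrib μ f s := by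
          rw [← measure_ofReal_lt_eq_distrib μ f (le_of_lt hs)]
          exact Measure.restrict_apply_le _ _
        have h2 : μ.restrict E {x | ENNReal.ofReal s < ENNReal.ofReal |f x|}
            ≤ ENNReal.ofReal t := by
          rw [← hE, ← Measure.restrict_apply_univ E]
          exact measure_mono (subset_univ _)
        refine ENNReal.le_of_forall_nnreal_lt fun r hr => ?_
        calc (r : ℝ≥0∞) = volume (Ioc (0:ℝ) r) := by simp
          _ ≤ _ := by
            refine measure_mono fun u hu => ⟨?_, hu.1, ?_⟩
            · refine lt_of_le_of_lt ?_ (hr.trans_le h1)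
              exact ENNReal.ofReal_le_of_le_toReal (by simpa using hu.2)
            · have := hr.trans_le h2
              refine hu.2.trans ?_
              rw [← ENNReal.ofReal_coe_nnreal] at this
              exact (ENNReal.ofReal_lt_ofReal_iff_of_nonneg r.2).1 this |>.le
    _ = ∫⁻ u in Ioc (0:ℝ) t, distribInv μ f u := by
        rw [lintegral_lintegral_swap]
        · refine lintegral_congr fun u => ?_
          have hms' : MeasurableSet {s : ℝ | ENNReal.ofReal u < distrib μ f s} :=
            measurableSet_lt measurable_const (distrib_antitone μ f).measurable
          rw [distribInv, ← lintegral_indicator_one hms']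
          rfl
        · exact (measurable_one.indicator hms).aemeasurable
    _ ≤ _ := lintegral_mono fun u => distribInv_le_rearr μ f u

lemma setLIntegral_le_lorentzNorm_mul {X : Type*} [MeasurableSpace X] (μ : Measure X) [SFinite μ]
    {f : X → ℝ} (hf : Measurable f) (q : ℝ) {E : Set X} (hE : μ E ≠ ⊤) :
    ∫⁻ x in E, ENNReal.ofReal |f x| ∂μ ≤ lorentzNorm μ f q⁻¹ ⊤ * μ E ^ (1 - q) := by
  rcases eq_or_ne (μ E) 0 with h0 | h0
  · simp [Measure.restrict_eq_zero.2 h0]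
  set t := (μ E).toReal
  have ht : 0 < t := ENNReal.toReal_pos h0 hE
  have hEt : μ E = ENNReal.ofReal t := (ENNReal.ofReal_toReal hE).symm
  have h1 : ENNReal.ofReal t ^ q * maxFn μ f t ≤ lorentzNorm μ f q⁻¹ ⊤ := by
    rw [lorentzNorm, if_pos rfl]
    refine le_trans (le_of_eq ?_) (le_iSup₂
      (f := fun (t : ℝ) (_ : 0 < t) => ENNReal.ofReal t ^ (1 / q⁻¹) * maxFn μ f t) t ht)
    rw [one_div, inv_inv]
  refine (setLIntegral_le_lintegral_rearr μ hf hEt).trans ?_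
  rw [maxFn] at h1
  have ht0 : ENNReal.ofReal t ≠ 0 := by simpa using ht
  have htt : ENNReal.ofReal t ≠ ⊤ := ENNReal.ofReal_ne_top
  rw [hEt]
  calc ∫⁻ u in Ioc (0:ℝ) t, rearr μ f u
      = (ENNReal.ofReal t ^ q * ((ENNReal.ofReal t)⁻¹ * ∫⁻ u in Ioc (0:ℝ) t, rearr μ f u)) *
          ENNReal.ofReal t ^ (1 - q) := by
        rw [mul_right_comm, ← ENNReal.rpow_add _ _ ht0 htt, add_sub_cancel, ENNReal.rpow_one,
          ← mul_assoc, ENNReal.mul_inv_cancel ht0 htt, one_mul]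
    _ ≤ _ := by gcongr

lemma lorentzNorm_comp {X : Type*} [MeasurableSpace X] {μ : Measure X} {T : X → X}
    (hT : MeasurePreserving T μ μ) {f : X → ℝ} (hf : Measurable f) (q : ℝ) (s : ℝ≥0∞) :
    lorentzNorm μ (f ∘ T) q s = lorentzNorm μ f q s := by
  have h : distrib μ (f ∘ T) = distrib μ f := by
    funext s
    have hms : MeasurableSet {x | s < |f x|} := measurableSet_lt measurable_const (by fun_prop)
    exact hT.measure_preimage hms.nullMeasurableSet
  simp only [lorentzNorm, maxFn, rearr, h]

lemma ofReal_mul_rpow_max_le_lintegral {l t β : ℝ} (ht : 0 < t) (hβ : 0 ≤ β) :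
    ENNReal.ofReal l * ENNReal.ofReal (max l t ^ (-β)) ≤
      ∫⁻ v in Ioi (0:ℝ), {v : ℝ | ENNReal.ofReal v < ENNReal.ofReal l}.indicator
        (fun v => ENNReal.ofReal (max v t ^ (-β))) v := by
  have hms : MeasurableSet {v : ℝ | ENNReal.ofReal v < ENNReal.ofReal l} :=
    measurableSet_lt ENNReal.measurable_ofReal measurable_const
  rw [lintegral_indicator hms, Measure.restrict_restrict hms, setOf_ofReal_lt_inter_Ioi]
  calc _ = ∫⁻ _ in Ioo 0 l, ENNReal.ofReal (max l t ^ (-β)) := by simp [mul_comm]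
    _ ≤ _ := by
      refine setLIntegral_mono' measurableSet_Ioo fun v hv => ENNReal.ofReal_le_ofReal ?_
      exact Real.rpow_le_rpow_of_nonpos (lt_max_of_lt_right ht)
        (max_le_max_right t hv.2.le) (by linarith)

section Convolution

variable {n : ℕ}

lemma setLIntegral_setLIntegral_sub_le {f : EuclideanSpace ℝ (Fin n) → ℝ} (hf : Measurable f)
    {β t : ℝ} (hβ : 0 ≤ β) (hβ1 : β ≤ 1) (ht : 0 < t) {E F : Set (EuclideanSpace ℝ (Fin n))}
    (hE : volume E = ENNReal.ofReal t) (hF : volume F ≠ ⊤) :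
    ∫⁻ y in F, ∫⁻ x in E, ENNReal.ofReal |f (x - y)| ≤
      lorentzNorm volume f β⁻¹ ⊤ * ENNReal.ofReal t *
        ∫⁻ v in Ioi (0:ℝ), {v : ℝ | ENNReal.ofReal v < volume F}.indicator
          (fun v => ENNReal.ofReal (max v t ^ (-β))) v := by
  set A := lorentzNorm volume f β⁻¹ ⊤
  set l := (volume F).toReal
  have hl : 0 ≤ l := ENNReal.toReal_nonneg
  have hFl : volume F = ENNReal.ofReal l := (ENNReal.ofReal_toReal hF).symm
  have h1 (y) : ∫⁻ x in E, ENNReal.ofReal |f (x - y)| ≤ A * volume E ^ (1 - β) := by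
    have := setLIntegral_le_lorentzNorm_mul volume
      (hf.comp (measurePreserving_sub_right volume y).measurable) β
      (hE.trans_ne ENNReal.ofReal_ne_top)
    rwa [lorentzNorm_comp (measurePreserving_sub_right volume y) hf] at this
  have h2 (x) : ∫⁻ y in F, ENNReal.ofReal |f (x - y)| ≤ A * volume F ^ (1 - β) := by
    have := setLIntegral_le_lorentzNorm_mul volume
      (hf.comp (Measure.measurePreserving_sub_left volume x).measurable) β hF
    rwa [lorentzNorm_comp (Measure.measurePreserving_sub_left volume x) hf] at this
  have hpow {s : ℝ} (hs : 0 ≤ s) : ENNReal.ofReal s ^ (1 - β) = ENNReal.ofReal (s ^ (1 - β)) :=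
    ENNReal.ofReal_rpow_of_nonneg hs (by linarith)
  have hpow' {s : ℝ} (hs : 0 < s) : s ^ (1 - β) = s * s ^ (-β) := by
    rw [sub_eq_add_neg, Real.rpow_add hs, Real.rpow_one]
  have h3 : ∫⁻ y in F, ∫⁻ x in E, ENNReal.ofReal |f (x - y)| ≤
      A * ENNReal.ofReal t * (ENNReal.ofReal l * ENNReal.ofReal (max l t ^ (-β))) := by
    rcases le_total l t with h | h
    · calc _ ≤ ∫⁻ _ in F, A * volume E ^ (1 - β) := lintegral_mono h1
        _ = _ := by
          rw [setLIntegral_const, hE, hFl, max_eq_right h, hpow ht.le, hpow' ht,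
            ENNReal.ofReal_mul ht.le]
          ring
    · calc _ = ∫⁻ x in E, ∫⁻ y in F, ENNReal.ofReal |f (x - y)| :=
            lintegral_lintegral_swap (Measurable.aemeasurable (by fun_prop))
        _ ≤ ∫⁻ _ in E, A * volume F ^ (1 - β) := lintegral_mono h2
        _ = _ := by
          rw [setLIntegral_const, hE, hFl, max_eq_left h, hpow hl, hpow' (ht.trans_le h),
            ENNReal.ofReal_mul hl]
          ring
  rw [hFl]
  exact h3.trans (mul_le_mul_right (ofReal_mul_rpow_max_le_lintegral ht hβ) _)

/-- The convolution of `|f|` and `|φ|`. -/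
noncomputable def absConv (f φ : EuclideanSpace ℝ (Fin n) → ℝ)
    (x : EuclideanSpace ℝ (Fin n)) : ℝ≥0∞ :=
  ∫⁻ y, ENNReal.ofReal |f (x - y)| * ENNReal.ofReal |φ y|

lemma measurable_absConv {f φ : EuclideanSpace ℝ (Fin n) → ℝ} (hf : Measurable f)
    (hφ : Measurable φ) : Measurable (absConv f φ) :=
  Measurable.lintegral_prod_right' (f := fun z : EuclideanSpace ℝ (Fin n) ×
    EuclideanSpace ℝ (Fin n) => ENNReal.ofReal |f (z.1 - z.2)| * ENNReal.ofReal |φ z.2|)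
    (by fun_prop)

lemma ofReal_abs_conv_le_absConv (f φ : EuclideanSpace ℝ (Fin n) → ℝ)
    (x : EuclideanSpace ℝ (Fin n)) : ENNReal.ofReal |conv f φ x| ≤ absConv f φ x := by
  rw [conv, ← Real.enorm_eq_ofReal_abs]
  refine (enorm_integral_le_lintegral_enorm _).trans (le_of_eq ?_)
  simp only [absConv, enorm_mul, Real.enorm_eq_ofReal_abs]

/-- `∫₀^∞ max(v, t)^(-β) φ*(v) dv`. -/
noncomputable def rearrPotential (β : ℝ) (φ : EuclideanSpace ℝ (Fin n) → ℝ) (t : ℝ) : ℝ≥0∞ :=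
  ∫⁻ v in Ioi (0:ℝ), ENNReal.ofReal (max v t ^ (-β)) * distribInv volume φ v

/-- Rearrangement inequality for the integral of a convolution over a set of measure `t`. -/
lemma setLIntegral_absConv_le {f φ : EuclideanSpace ℝ (Fin n) → ℝ} (hf : Measurable f)
    (hφ : Measurable φ) (hfin : ∀ u, 0 < u → distrib volume φ u ≠ ⊤)
    {β t : ℝ} (hβ : 0 ≤ β) (hβ1 : β ≤ 1) (ht : 0 < t) {E : Set (EuclideanSpace ℝ (Fin n))}
    (hE : volume E = ENNReal.ofReal t) :
    ∫⁻ x in E, absConv f φ x ≤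
      lorentzNorm volume f β⁻¹ ⊤ * ENNReal.ofReal t * rearrPotential β φ t := by
  set w : EuclideanSpace ℝ (Fin n) → ℝ≥0∞ := fun y => ∫⁻ x in E, ENNReal.ofReal |f (x - y)|
  have hw : Measurable w := Measurable.lintegral_prod_right' (f := fun z :
    EuclideanSpace ℝ (Fin n) × EuclideanSpace ℝ (Fin n) => ENNReal.ofReal |f (z.2 - z.1)|)
    (by fun_prop)
  have hd := (distrib_antitone volume φ).measurable
  have hms : MeasurableSet {z : ℝ × ℝ | ENNReal.ofReal z.2 < distrib volume φ z.1} :=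
    measurableSet_lt (by fun_prop) (hd.comp measurable_fst)
  have hmeas : Measurable (fun z : ℝ × ℝ => {v : ℝ | ENNReal.ofReal v <
      distrib volume φ z.1}.indicator (fun v => ENNReal.ofReal (max v t ^ (-β))) z.2) :=
    Measurable.indicator (f := fun z : ℝ × ℝ => ENNReal.ofReal (max z.2 t ^ (-β)))
      (by fun_prop) hms
  calc ∫⁻ x in E, absConv f φ x
      = ∫⁻ y, w y * ENNReal.ofReal |φ y| := by
        simp only [absConv]
        rw [lintegral_lintegral_swap (Measurable.aemeasurable (by fun_prop))]
        exact lintegral_congr fun y => lintegral_mul_const _ (by fun_prop)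
    _ = ∫⁻ y, ENNReal.ofReal |φ y| ∂(volume.withDensity w) :=
        (lintegral_withDensity_eq_lintegral_mul _ hw (by fun_prop)).symm
    _ = ∫⁻ u in Ioi (0:ℝ),
          volume.withDensity w {y | ENNReal.ofReal u < ENNReal.ofReal |φ y|} :=
        lintegral_eq_lintegral_measure_ofReal_lt _ (by fun_prop)
    _ ≤ ∫⁻ u in Ioi (0:ℝ), lorentzNorm volume f β⁻¹ ⊤ * ENNReal.ofReal t *
          ∫⁻ v in Ioi (0:ℝ), {v : ℝ | ENNReal.ofReal v < distrib volume φ u}.indicator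
            (fun v => ENNReal.ofReal (max v t ^ (-β))) v := by
        refine setLIntegral_mono' measurableSet_Ioi fun u hu => ?_
        have hu0 : 0 ≤ u := le_of_lt hu
        rw [withDensity_apply _ (measurableSet_lt measurable_const (by fun_prop)),
          ← measure_ofReal_lt_eq_distrib volume φ hu0]
        refine setLIntegral_setLIntegral_sub_le hf hβ hβ1 ht hE ?_
        rw [measure_ofReal_lt_eq_distrib volume φ hu0]
        exact hfin u hu
    _ = _ := by
        rw [lintegral_const_mul _ hmeas.lintegral_prod_right', rearrPotential,
          lintegral_lintegral_swap hmeas.aemeasurable]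
        congr 1
        refine lintegral_congr fun v => ?_
        have hms' : MeasurableSet {u : ℝ | ENNReal.ofReal v < distrib volume φ u} :=
          measurableSet_lt measurable_const hd
        rw [distribInv, ← lintegral_indicator_const hms']
        rfl

lemma rearrPotential_antitone {β : ℝ} (hβ : 0 ≤ β) (φ : EuclideanSpace ℝ (Fin n) → ℝ) :
    AntitoneOn (rearrPotential β φ) (Ioi 0) := by
  intro s hs t _ hst
  refine lintegral_mono fun v => ?_
  gcongr ENNReal.ofReal ?_ * _
  exact Real.rpow_le_rpow_of_nonpos (lt_max_of_lt_right hs) (max_le_max_left v hst) (by linarith)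

lemma measurable_rearrPotential (β : ℝ) (φ : EuclideanSpace ℝ (Fin n) → ℝ) :
    Measurable (rearrPotential β φ) := by
  have h := (distribInv_antitone volume φ).measurable
  exact Measurable.lintegral_prod_right' (f := fun z : ℝ × ℝ =>
    ENNReal.ofReal (max z.2 z.1 ^ (-β)) * distribInv volume φ z.2) (by fun_prop)

lemma measure_absConv_gt_le {f φ : EuclideanSpace ℝ (Fin n) → ℝ} (hf : Measurable f)
    (hφ : Measurable φ) (hfin : ∀ u, 0 < u → distrib volume φ u ≠ ⊤)
    {β : ℝ} (hβ : 0 ≤ β) (hβ1 : β ≤ 1) (s : ℝ) :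
    volume {x | ENNReal.ofReal s < absConv f φ x} ≤ volume.restrict (Ioi (0:ℝ))
      {t | ENNReal.ofReal s < lorentzNorm volume f β⁻¹ ⊤ * rearrPotential β φ t} := by
  have hH := measurable_absConv hf hφ
  have hms : MeasurableSet {x | ENNReal.ofReal s < absConv f φ x} :=
    measurableSet_lt measurable_const hH
  refine le_of_forall_lt fun c hc => ?_
  obtain ⟨E, hE, hEs, hcE, hEtop⟩ := Measure.exists_subset_measure_lt_top hms hc
  refine hcE.trans_le ?_
  have hE0 : volume E ≠ 0 := (zero_le.trans_lt hcE).ne'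
  set t := (volume E).toReal
  have ht : 0 < t := ENNReal.toReal_pos hE0 hEtop.ne
  have hEt : volume E = ENNReal.ofReal t := (ENNReal.ofReal_toReal hEtop.ne).symm
  have h1 : ∫⁻ _ in E, ENNReal.ofReal s < ∫⁻ x in E, absConv f φ x := by
    refine setLIntegral_strict_mono hE hE0 hH ?_ (ae_of_all _ fun x hx => hEs hx)
    rw [setLIntegral_const]
    exact ENNReal.mul_ne_top ENNReal.ofReal_ne_top hEtop.ne
  replace h1 := h1.trans_le (setLIntegral_absConv_le hf hφ hfin hβ hβ1 ht hEt)
  rw [setLIntegral_const, hEt, mul_right_comm] at h1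
  replace h1 := lt_of_mul_lt_mul_right' h1
  have hms' : MeasurableSet
      {t | ENNReal.ofReal s < lorentzNorm volume f β⁻¹ ⊤ * rearrPotential β φ t} :=
    measurableSet_lt measurable_const ((measurable_rearrPotential β φ).const_mul _)
  rw [Measure.restrict_apply hms', hEt]
  calc ENNReal.ofReal t = volume (Ioc 0 t) := by simp
    _ ≤ _ := by
      refine measure_mono fun t' ht' => ⟨?_, ht'.1⟩
      refine h1.trans_le ?_
      gcongr
      exact rearrPotential_antitone hβ φ ht'.1 ht ht'.2

/-- The `L^r` norm of a convolution is controlled by that of the rearranged potential. -/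
lemma lintegral_absConv_rpow_le {f φ : EuclideanSpace ℝ (Fin n) → ℝ} (hf : Measurable f)
    (hφ : Measurable φ) (hfin : ∀ u, 0 < u → distrib volume φ u ≠ ⊤)
    {β r : ℝ} (hβ : 0 ≤ β) (hβ1 : β ≤ 1) (hr : 0 < r) :
    ∫⁻ x, absConv f φ x ^ r ≤
      lorentzNorm volume f β⁻¹ ⊤ ^ r * ∫⁻ t in Ioi (0:ℝ), rearrPotential β φ t ^ r := by
  have hG := measurable_rearrPotential β φ
  calc _ ≤ ∫⁻ t in Ioi (0:ℝ), (lorentzNorm volume f β⁻¹ ⊤ * rearrPotential β φ t) ^ r :=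
        lintegral_rpow_le_of_measure_le (measurable_absConv hf hφ) (hG.const_mul _) hr
          fun s _ => measure_absConv_gt_le hf hφ hfin hβ hβ1 s
    _ = _ := by
        simp_rw [ENNReal.mul_rpow_of_nonneg _ _ hr.le]
        rw [lintegral_const_mul _ (hG.pow_const r)]

end Convolution

/-- The Schur test. -/
lemma lintegral_rpow_lintegral_mul_le_of_schur {X Y : Type*} [MeasurableSpace X]
    [MeasurableSpace Y] {μ : Measure X} {ν : Measure Y} [SFinite μ] [SFinite ν] {p q : ℝ}
    (hpq : p.HolderConjugate q) {K : X → Y → ℝ≥0∞} (hK : Measurable (Function.uncurry K))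
    {a : Y → ℝ≥0∞} {b : X → ℝ≥0∞} (ha : Measurable a) (hb : Measurable b)
    (ha0 : ∀ᵐ y ∂ν, a y ≠ 0) (ha_top : ∀ᵐ y ∂ν, a y ≠ ⊤) {C : ℝ≥0∞}
    (h1 : ∀ᵐ x ∂μ, ∫⁻ y, K x y * a y ^ (-q) ∂ν ≤ C * b x ^ (-q))
    (h2 : ∀ᵐ y ∂ν, ∫⁻ x, K x y * b x ^ (-p) ∂μ ≤ C * a y ^ (-p))
    {g : Y → ℝ≥0∞} (hg : Measurable g) :
    ∫⁻ x, (∫⁻ y, K x y * g y ∂ν) ^ p ∂μ ≤ C ^ p * ∫⁻ y, g y ^ p ∂ν := by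
  have hp := hpq.pos
  have hq := hpq.symm.pos
  have hKx (x) : Measurable (K x) := hK.comp measurable_prodMk_left
  have hKy (y) : Measurable fun x => K x y := hK.comp measurable_prodMk_right
  have hK' : Measurable fun z : X × Y => K z.1 z.2 := hK
  have step (x : X) : (∫⁻ y, K x y * g y ∂ν) ^ p ≤
      (∫⁻ y, K x y * a y ^ (-q) ∂ν) ^ (p / q) * ∫⁻ y, K x y * (a y ^ p * g y ^ p) ∂ν := by
    have hsplit : ∫⁻ y, K x y * g y ∂ν = ∫⁻ y, ((fun y => K x y ^ (1 / q) * (a y)⁻¹) *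
        fun y => K x y ^ (1 / p) * (a y * g y)) y ∂ν := by
      refine lintegral_congr_ae ?_
      filter_upwards [ha0, ha_top] with y h0 ht
      have : K x y = K x y ^ (1 / q) * K x y ^ (1 / p) := by
        rw [← ENNReal.rpow_add_of_nonneg _ _ (by positivity) (by positivity)]
        simp [one_div, hpq.symm.inv_add_inv_eq_one]
      simp only [Pi.mul_apply]
      calc K x y * g y = K x y ^ (1 / q) * K x y ^ (1 / p) * ((a y)⁻¹ * a y) * g y := by
            rw [← this, ENNReal.inv_mul_cancel h0 ht, mul_one]
        _ = _ := by ring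
    have hH := ENNReal.lintegral_mul_le_Lp_mul_Lq ν hpq.symm
      (f := fun y => K x y ^ (1 / q) * (a y)⁻¹) (g := fun y => K x y ^ (1 / p) * (a y * g y))
      (((hKx x).pow_const _).mul ha.inv).aemeasurable
      (((hKx x).pow_const _).mul (ha.mul hg)).aemeasurable
    rw [← hsplit] at hH
    calc _ ≤ _ := ENNReal.rpow_le_rpow hH hp.le
      _ = _ := by
        rw [ENNReal.mul_rpow_of_nonneg _ _ hp.le, ← ENNReal.rpow_mul, ← ENNReal.rpow_mul,
          one_div_mul_cancel hp.ne', ENNReal.rpow_one, one_div_mul_eq_div]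
        congr 2
        · refine lintegral_congr fun y => ?_
          rw [ENNReal.mul_rpow_of_nonneg _ _ hq.le, ← ENNReal.rpow_mul,
            one_div_mul_cancel hq.ne', ENNReal.rpow_one, ENNReal.inv_rpow, ENNReal.rpow_neg]
        · funext y
          rw [ENNReal.mul_rpow_of_nonneg _ _ hp.le, ← ENNReal.rpow_mul,
            one_div_mul_cancel hp.ne', ENNReal.rpow_one, ENNReal.mul_rpow_of_nonneg _ _ hp.le]
  have hpq1 : p / q + 1 = p := by
    have := hpq.symm.inv_add_inv_eq_one
    field_simp at this ⊢
    linarith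
  calc ∫⁻ x, (∫⁻ y, K x y * g y ∂ν) ^ p ∂μ
      ≤ ∫⁻ x, C ^ (p / q) * ∫⁻ y, K x y * b x ^ (-p) * (a y ^ p * g y ^ p) ∂ν ∂μ := by
        refine lintegral_mono_ae ?_
        filter_upwards [h1] with x hx
        refine (step x).trans ?_
        calc _ ≤ (C * b x ^ (-q)) ^ (p / q) * ∫⁻ y, K x y * (a y ^ p * g y ^ p) ∂ν := by
              gcongr
          _ = C ^ (p / q) * (b x ^ (-p) * ∫⁻ y, K x y * (a y ^ p * g y ^ p) ∂ν) := by
              rw [ENNReal.mul_rpow_of_nonneg _ _ (by positivity), ← ENNReal.rpow_mul, mul_assoc]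
              congr 4
              field_simp
          _ = _ := by
              rw [← lintegral_const_mul _ (show Measurable fun y => K x y * (a y ^ p * g y ^ p) from
                (hKx x).mul ((ha.pow_const p).mul (hg.pow_const p)))]
              congr 1
              exact lintegral_congr fun y => by ring
    _ = C ^ (p / q) * ∫⁻ y, (∫⁻ x, K x y * b x ^ (-p) ∂μ) * (a y ^ p * g y ^ p) ∂ν := by
        have hm : Measurable fun z : X × Y =>
            K z.1 z.2 * b z.1 ^ (-p) * (a z.2 ^ p * g z.2 ^ p) := by fun_prop
        rw [lintegral_const_mul _ hm.lintegral_prod_right', lintegral_lintegral_swap hm.aemeasurable]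
        congr 1
        refine lintegral_congr fun y => ?_
        dsimp only
        exact lintegral_mul_const (f := fun x => K x y * b x ^ (-p)) _
          ((hKy y).mul (hb.pow_const _))
    _ ≤ C ^ (p / q) * ∫⁻ y, C * g y ^ p ∂ν := by
        gcongr C ^ (p / q) * ?_
        refine lintegral_mono_ae ?_
        filter_upwards [h2, ha0, ha_top] with y hy h0 ht
        calc _ ≤ C * a y ^ (-p) * (a y ^ p * g y ^ p) := by gcongr
          _ = C * (a y ^ (-p) * a y ^ p) * g y ^ p := by ring
          _ = _ := by rw [← ENNReal.rpow_add _ _ h0 ht, neg_add_cancel, ENNReal.rpow_zero, mul_one]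
    _ = _ := by
        rw [lintegral_const_mul _ (hg.pow_const p), ← mul_assoc]
        congr 1
        conv_rhs => rw [← hpq1, ENNReal.rpow_add_of_nonneg _ _ (by positivity) zero_le_one,
          ENNReal.rpow_one]

lemma lintegral_rpow_max_mul_rpow {a b t : ℝ} (ha : 0 < a) (hb : 0 < b) (ht : 0 < t) :
    ∫⁻ v in Ioi (0:ℝ), ENNReal.ofReal (max v t ^ (-(a + b))) * ENNReal.ofReal (v ^ (a - 1)) =
      ENNReal.ofReal ((1 / a + 1 / b) * t ^ (-b)) := by
  rw [← Ioc_union_Ioi_eq_Ioi ht.le, lintegral_union measurableSet_Ioi Ioc_disjoint_Ioi_same]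
  have h1 : ∫⁻ v in Ioc 0 t, ENNReal.ofReal (max v t ^ (-(a + b))) * ENNReal.ofReal (v ^ (a - 1))
      = ENNReal.ofReal (1 / a * t ^ (-b)) := by
    calc _ = ∫⁻ v in Ioc 0 t, ENNReal.ofReal (t ^ (-(a + b))) * ENNReal.ofReal (v ^ (a - 1)) :=
          setLIntegral_congr_fun measurableSet_Ioc fun v hv => by simp only [max_eq_right hv.2]
      _ = _ := by
        rw [lintegral_const_mul _ (by fun_prop), lintegral_Ioc_rpow_sub_one ha ht.le,
          ← ENNReal.ofReal_mul (by positivity), ← mul_div_assoc, ← Real.rpow_add ht,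
          show -(a + b) + a = -b by ring]
        congr 1
        ring
  have h2 : ∫⁻ v in Ioi t, ENNReal.ofReal (max v t ^ (-(a + b))) * ENNReal.ofReal (v ^ (a - 1))
      = ENNReal.ofReal (1 / b * t ^ (-b)) := by
    calc _ = ∫⁻ v in Ioi t, ENNReal.ofReal (v ^ (-b - 1)) := by
          refine setLIntegral_congr_fun measurableSet_Ioi fun v hv => ?_
          have hv0 : 0 < v := ht.trans hv
          rw [max_eq_left (le_of_lt hv), ← ENNReal.ofReal_mul (by positivity),
            ← Real.rpow_add hv0]
          congr 2
          ring
      _ = _ := by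
        rw [lintegral_Ioi_rpow_neg_sub_one hb ht]
        congr 1
        ring
  rw [h1, h2, ← ENNReal.ofReal_add (by positivity) (by positivity)]
  congr 1
  ring

/-- A Hardy inequality for the kernel `max(v, t)^(-β)`. -/
lemma lintegral_rpow_mul_lintegral_rpow_max_le {p q r : ℝ} (hpq : p.HolderConjugate q)
    (hr : 0 < r) {g : ℝ → ℝ≥0∞} (hg : Measurable g) :
    ∫⁻ t in Ioi (0:ℝ), ENNReal.ofReal (t ^ (p / r - 1)) *
        (∫⁻ v in Ioi (0:ℝ), ENNReal.ofReal (max v t ^ (-(1 / q + 1 / r))) * g v) ^ p ≤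
      ENNReal.ofReal (q + r) ^ p * ∫⁻ v in Ioi (0:ℝ), g v ^ p := by
  have hp := hpq.pos
  have hq := hpq.symm.pos
  have hinv : 1 / p + 1 / q = 1 := by simpa [one_div] using hpq.inv_add_inv_eq_one
  set K : ℝ → ℝ → ℝ≥0∞ := fun t v =>
    ENNReal.ofReal (t ^ (1 / r - 1 / p)) * ENNReal.ofReal (max v t ^ (-(1 / q + 1 / r)))
  set a : ℝ → ℝ≥0∞ := fun v => ENNReal.ofReal (v ^ (1 / (p * q)))
  have ha {v : ℝ} (hv : 0 < v) (e : ℝ) : a v ^ e = ENNReal.ofReal (v ^ (1 / (p * q) * e)) := by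
    simp only [a]
    rw [ENNReal.ofReal_rpow_of_pos (by positivity), ← Real.rpow_mul hv.le]
  have haq {v : ℝ} (hv : 0 < v) : a v ^ (-q) = ENNReal.ofReal (v ^ (1 / q - 1)) := by
    rw [ha hv]
    congr 2
    rw [show 1 / q - 1 = -(1 / p) by linarith]
    field_simp
  have hap {v : ℝ} (hv : 0 < v) : a v ^ (-p) = ENNReal.ofReal (v ^ (-(1 / q))) := by
    rw [ha hv]
    congr 2
    field_simp
  have schur := lintegral_rpow_lintegral_mul_le_of_schur (μ := volume.restrict (Ioi (0:ℝ)))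
    (ν := volume.restrict (Ioi (0:ℝ))) hpq (K := K) (a := a) (b := a) (C := ENNReal.ofReal (q + r))
    (by simp only [K, Function.uncurry_def]; fun_prop) (by fun_prop) (by fun_prop)
    (by
      filter_upwards [ae_restrict_mem measurableSet_Ioi] with v hv
      have hv0 : 0 < v := hv
      simp only [a, ne_eq, ENNReal.ofReal_eq_zero, not_le]
      positivity)
    (ae_of_all _ fun v => ENNReal.ofReal_ne_top)
    (by
      filter_upwards [ae_restrict_mem measurableSet_Ioi] with t ht
      have ht0 : 0 < t := ht
      rw [haq ht0, ← ENNReal.ofReal_mul (by positivity)]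
      simp only [K, mul_assoc]
      rw [lintegral_const_mul _ (by fun_prop), setLIntegral_congr_fun (g := fun v =>
        ENNReal.ofReal (max v t ^ (-(1 / q + 1 / r))) * ENNReal.ofReal (v ^ (1 / q - 1)))
        measurableSet_Ioi fun v hv => by simp only [haq (mem_Ioi.1 hv)],
        lintegral_rpow_max_mul_rpow (by positivity) (by positivity) ht0,
        ← ENNReal.ofReal_mul (by positivity), mul_left_comm, ← Real.rpow_add ht0]
      refine le_of_eq ?_
      congr 2
      · simp
      · congr 1
        linarith)
    (by
      filter_upwards [ae_restrict_mem measurableSet_Ioi] with v hv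
      have hv0 : 0 < v := hv
      rw [hap hv0, ← ENNReal.ofReal_mul (by positivity), setLIntegral_congr_fun (g := fun t =>
        ENNReal.ofReal (max t v ^ (-(1 / r + 1 / q))) * ENNReal.ofReal (t ^ (1 / r - 1)))
        measurableSet_Ioi,
        lintegral_rpow_max_mul_rpow (by positivity) (by positivity) hv0]
      · refine le_of_eq ?_
        congr 2
        simp [add_comm]
      · intro t ht
        have ht0 : 0 < t := ht
        simp only [K]
        rw [hap ht0, mul_right_comm, ← ENNReal.ofReal_mul (by positivity), ← Real.rpow_add ht0,
          mul_comm, max_comm, add_comm (1 / q)]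
        congr 3
        linarith)
    hg
  refine le_trans (le_of_eq ?_) schur
  refine setLIntegral_congr_fun measurableSet_Ioi fun t ht => ?_
  have ht0 : 0 < t := ht
  simp only [K, mul_assoc]
  rw [lintegral_const_mul _ (by fun_prop), ENNReal.mul_rpow_of_nonneg _ _ hp.le,
    ENNReal.ofReal_rpow_of_pos (by positivity), ← Real.rpow_mul ht0.le]
  congr 3
  field_simp

/-- The embedding `L^{r,p} ⊆ L^r` for decreasing functions. -/
lemma lintegral_rpow_le_of_antitoneOn {G : ℝ → ℝ≥0∞} (hG : Measurable G)
    (hanti : AntitoneOn G (Ioi 0)) {p r : ℝ} (hp : 0 < p) (hpr : p ≤ r) :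
    ∫⁻ t in Ioi (0:ℝ), G t ^ r ≤ ENNReal.ofReal (p / r) ^ ((r - p) / p) *
      (∫⁻ t in Ioi (0:ℝ), ENNReal.ofReal (t ^ (p / r - 1)) * G t ^ p) ^ (r / p) := by
  have hr : 0 < r := hp.trans_le hpr
  set N := ∫⁻ t in Ioi (0:ℝ), ENNReal.ofReal (t ^ (p / r - 1)) * G t ^ p
  have hd : 0 ≤ (r - p) / p := div_nonneg (by linarith) hp.le
  have hpt {t : ℝ} (ht : 0 < t) : G t ^ p ≤ ENNReal.ofReal (p / r * t ^ (-(p / r))) * N := by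
    have h1 : ENNReal.ofReal (t ^ (p / r) / (p / r)) * G t ^ p ≤ N := by
      rw [← lintegral_Ioc_rpow_sub_one (by positivity) ht.le,
        ← lintegral_mul_const _ (by fun_prop)]
      refine le_trans ?_ (lintegral_mono_set (show Ioc 0 t ⊆ Ioi 0 from Ioc_subset_Ioi_self))
      refine setLIntegral_mono' measurableSet_Ioc fun s hs => ?_
      gcongr
      exact hanti hs.1 ht hs.2
    calc G t ^ p = ENNReal.ofReal (p / r * t ^ (-(p / r))) *
          (ENNReal.ofReal (t ^ (p / r) / (p / r)) * G t ^ p) := by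
          rw [← mul_assoc, ← ENNReal.ofReal_mul (by positivity), Real.rpow_neg ht.le]
          have : p / r * (t ^ (p / r))⁻¹ * (t ^ (p / r) / (p / r)) = 1 := by
            have : t ^ (p / r) ≠ 0 := by positivity
            field_simp
          rw [this, ENNReal.ofReal_one, one_mul]
      _ ≤ _ := by gcongr
  calc ∫⁻ t in Ioi (0:ℝ), G t ^ r
      ≤ ∫⁻ t in Ioi (0:ℝ), ENNReal.ofReal (p / r) ^ ((r - p) / p) * N ^ ((r - p) / p) *
          (ENNReal.ofReal (t ^ (p / r - 1)) * G t ^ p) := by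
        refine setLIntegral_mono' measurableSet_Ioi fun t ht => ?_
        have ht0 : 0 < t := ht
        calc G t ^ r = (G t ^ p) ^ ((r - p) / p) * G t ^ p := by
              rw [← ENNReal.rpow_mul, ← ENNReal.rpow_add_of_nonneg _ _ (by positivity) hp.le]
              congr 1
              field_simp
              ring
          _ ≤ (ENNReal.ofReal (p / r * t ^ (-(p / r))) * N) ^ ((r - p) / p) * G t ^ p := by
              gcongr
              exact hpt ht0
          _ = _ := by
              rw [ENNReal.mul_rpow_of_nonneg _ _ hd, ENNReal.ofReal_mul (by positivity),
                ENNReal.mul_rpow_of_nonneg _ _ hd,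
                ENNReal.ofReal_rpow_of_pos (x := t ^ (-(p / r))) (by positivity),
                ← Real.rpow_mul ht0.le,
                show -(p / r) * ((r - p) / p) = p / r - 1 by field_simp; ring]
              ring
    _ = _ := by
        rw [lintegral_const_mul _ (by fun_prop), mul_assoc]
        congr 1
        change N ^ ((r - p) / p) * N = _
        conv_lhs => rw [← ENNReal.rpow_one N, ← ENNReal.rpow_mul,
          ← ENNReal.rpow_add_of_nonneg _ _ (by simpa using hd) zero_le_one]
        congr 1
        field_simp
        ring

lemma distrib_ne_top_of_lintegral_rpow {X : Type*} [MeasurableSpace X] {μ : Measure X}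
    {f : X → ℝ} (hf : Measurable f) {p : ℝ} (hp : 0 < p)
    (h : ∫⁻ x, ENNReal.ofReal |f x| ^ p ∂μ ≠ ⊤) {s : ℝ} (hs : 0 < s) : distrib μ f s ≠ ⊤ := by
  intro htop
  have hs0 : ENNReal.ofReal s ^ p ≠ 0 := by simp [hs]
  have h1 := mul_meas_ge_le_lintegral (μ := μ)
    (f := fun x => ENNReal.ofReal |f x| ^ p) (by fun_prop) (ENNReal.ofReal s ^ p)
  have h2 : distrib μ f s ≤ μ {x | ENNReal.ofReal s ^ p ≤ ENNReal.ofReal |f x| ^ p} :=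
    measure_mono fun x hx =>
      ENNReal.rpow_le_rpow (ENNReal.ofReal_le_ofReal (le_of_lt hx)) hp.le
  rw [htop, top_le_iff] at h2
  rw [h2, ENNReal.mul_top hs0, top_le_iff] at h1
  exact h h1

/-- For `1 < p < ∞`, `0 < α < n/p` and `1/r = 1/p - α/n`: if
`f ∈ L^{n/(n-α),∞}(ℝⁿ)` and `φ ∈ L^p(ℝⁿ)`, then `f∗φ ∈ L^r(ℝⁿ)` and
`‖f∗φ‖_r ≤ 3 r (p/(p-1)) (p/r)^{1/p-1/r} ‖f‖_{n/(n-α),∞} ‖φ‖_p`. -/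
theorem frac_conv_lebesgue (n : ℕ) (hn : 1 ≤ n)
    (p r α : ℝ) (hp : 1 < p)
    (hα : 0 < α) (hαp : α < (n:ℝ) / p)
    (hr : 1 / r = 1 / p - α / (n:ℝ))
    (f φ : EuclideanSpace ℝ (Fin n) → ℝ) (hf : Measurable f) (hφ : Measurable φ)
    (hfL : lorentzNorm volume f ((n:ℝ) / ((n:ℝ) - α)) ⊤ < ⊤)
    (hφL : lpNorm volume φ p < ⊤) :
    lpNorm volume (conv f φ) r < ⊤ ∧
      lpNorm volume (conv f φ) r ≤
        ENNReal.ofReal (3 * r * (p / (p - 1)) * (p / r) ^ (1 / p - 1 / r)) *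
          lorentzNorm volume f ((n:ℝ) / ((n:ℝ) - α)) ⊤ * lpNorm volume φ p := by
  have hp0 : 0 < p := by linarith
  have hn0 : (0:ℝ) < n := by exact_mod_cast hn
  have hαn : α / n < 1 / p := by
    rw [div_lt_div_iff₀ hn0 hp0]
    rw [lt_div_iff₀ hp0] at hαp
    linarith
  have hαn0 : 0 < α / n := by positivity
  have hr0 : 0 < r := one_div_pos.1 (by linarith)
  have hpr : p ≤ r := (one_div_le_one_div hr0 hp0).1 (by linarith)
  have hpq : p.HolderConjugate (p / (p - 1)) := Real.HolderConjugate.conjExponent hp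
  set q := p / (p - 1)
  have hq1 : 1 < q := hpq.symm.lt
  have hinv : 1 / p + 1 / q = 1 := by simpa [one_div] using hpq.inv_add_inv_eq_one
  set β := 1 / q + 1 / r with hβdef
  have hβ : β = 1 - α / n := by linarith
  have hβ0 : 0 ≤ β := by positivity
  have hβ1 : β ≤ 1 := by linarith
  have hLor : (n:ℝ) / (n - α) = β⁻¹ := by
    rw [hβ, one_sub_div hn0.ne', inv_div]
  rw [hLor] at hfL ⊢
  set A := lorentzNorm volume f β⁻¹ ⊤
  have hφint : ∫⁻ x, ENNReal.ofReal |φ x| ^ p ≠ ⊤ := by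
    intro h
    rw [_root_.lpNorm, h, ENNReal.top_rpow_of_pos (by positivity)] at hφL
    exact lt_irrefl _ hφL
  have hN : ∫⁻ t in Ioi (0:ℝ), ENNReal.ofReal (t ^ (p / r - 1)) * rearrPotential β φ t ^ p ≤
      ENNReal.ofReal (q + r) ^ p * ∫⁻ x, ENNReal.ofReal |φ x| ^ p :=
    (lintegral_rpow_mul_lintegral_rpow_max_le hpq hr0
      (distribInv_antitone volume φ).measurable).trans
      (mul_le_mul_right (lintegral_distribInv_rpow_le volume hφ hp0) _)
  have hmain : lpNorm volume (conv f φ) r ≤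
      ENNReal.ofReal ((p / r) ^ (1 / p - 1 / r) * (q + r)) * A * lpNorm volume φ p := by
    calc lpNorm volume (conv f φ) r
        ≤ (A ^ r * (ENNReal.ofReal (p / r) ^ ((r - p) / p) *
            (ENNReal.ofReal (q + r) ^ p * ∫⁻ x, ENNReal.ofReal |φ x| ^ p) ^ (r / p))) ^
              (1 / r) := by
          refine ENNReal.rpow_le_rpow ?_ (by positivity)
          calc _ ≤ ∫⁻ x, absConv f φ x ^ r := by
                gcongr
                exact ofReal_abs_conv_le_absConv f φ _
            _ ≤ A ^ r * ∫⁻ t in Ioi (0:ℝ), rearrPotential β φ t ^ r :=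
                lintegral_absConv_rpow_le hf hφ
                  (fun u hu => distrib_ne_top_of_lintegral_rpow hφ hp0 hφint hu) hβ0 hβ1 hr0
            _ ≤ _ := by
                gcongr
                refine (lintegral_rpow_le_of_antitoneOn (measurable_rearrPotential β φ)
                  (rearrPotential_antitone hβ0 φ) hp0 hpr).trans ?_
                gcongr
      _ = _ := by
          have hr' : 0 ≤ 1 / r := by positivity
          rw [ENNReal.mul_rpow_of_nonneg _ _ hr', ENNReal.mul_rpow_of_nonneg _ _ hr',
            ← ENNReal.rpow_mul, mul_one_div_cancel hr0.ne', ENNReal.rpow_one,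
            ← ENNReal.rpow_mul, ← ENNReal.rpow_mul,
            show r / p * (1 / r) = 1 / p by field_simp,
            show (r - p) / p * (1 / r) = 1 / p - 1 / r by field_simp,
            ENNReal.mul_rpow_of_nonneg _ _ (by positivity), ← ENNReal.rpow_mul,
            mul_one_div_cancel hp0.ne', ENNReal.rpow_one,
            ENNReal.ofReal_rpow_of_pos (by positivity), ENNReal.ofReal_mul (by positivity),
            _root_.lpNorm]
          ring
  have hC : (p / r) ^ (1 / p - 1 / r) * (q + r) ≤ 3 * r * q * (p / r) ^ (1 / p - 1 / r) := by
    rw [mul_comm]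
    gcongr
    nlinarith
  have hbound := hmain.trans (mul_le_mul_left (mul_le_mul_left (ENNReal.ofReal_le_ofReal hC) A) _)
  exact ⟨hbound.trans_lt (ENNReal.mul_lt_top (ENNReal.mul_lt_top ENNReal.ofReal_lt_top hfL) hφL),
    hbound⟩
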